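/- Let (X,Y) be a zero-mean jointly Gaussian random vector with X ∈ ℝ^{d_X}, Y ∈ ℝ^{d_Y}. Let V be an ℕ-valued random variable with finite Shannon entropy, let A ∈ ℝ^{d_W×(d_X+d_Y)}, set W = A·[X;Y], and suppose X and Y are conditionally independent given the σ-algebra generated by (V,W). Let N_X ∈ ℝ^{r×d_X} be a matrix such that the covariance matrix of N_X X is invertible, and suppose there exists a matrix N_Y with N_X X = N_Y Y almost surely. Then there exists a matrix A' ∈ ℝ^{r×d_W} with N_X X = A' W almost surely, and d_W ≥ r. -/

import Mathlib

noncomputable section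

open MeasureTheory ProbabilityTheory Matrix

/-- A random vector is (jointly) Gaussian if every linear functional of it has a
(possibly degenerate) Gaussian distribution on `ℝ`. -/
def IsGaussianVec {Ω : Type*} [MeasurableSpace Ω] (P : Measure Ω) {ι : Type*} [Fintype ι]
    (Z : Ω → ι → ℝ) : Prop :=
  ∀ a : ι → ℝ, ∃ (m : ℝ) (v : NNReal),
    P.map (fun ω => ∑ i, a i * Z ω i) = gaussianReal m v

/-- Finite Shannon entropy of an `ℕ`-valued random variable. -/
def HasFiniteEntropy {Ω : Type*} [MeasurableSpace Ω] (P : Measure Ω) (V : Ω → ℕ) : Prop :=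
  Summable fun n => Real.negMulLog (P (V ⁻¹' {n})).toReal

/-- Conditional independence of two random vectors given a sub-σ-algebra `m`. -/
def CondIndepRV {Ω : Type*} [MeasurableSpace Ω] (P : Measure Ω)
    (m : MeasurableSpace Ω) {α β : Type*} [MeasurableSpace α] [MeasurableSpace β]
    (X : Ω → α) (Y : Ω → β) : Prop :=
  ∀ (A : Set α) (B : Set β), MeasurableSet A → MeasurableSet B →
    (P[((X ⁻¹' A) ∩ (Y ⁻¹' B)).indicator (fun _ => (1 : ℝ)) | m]) =ᵐ[P]
      fun ω => (P[(X ⁻¹' A).indicator (fun _ => (1 : ℝ)) | m]) ω *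
        (P[(Y ⁻¹' B).indicator (fun _ => (1 : ℝ)) | m]) ω

/-- A measurable jointly Gaussian vector has a Gaussian law. -/
lemma IsGaussianVec.hasGaussianLaw {Ω : Type*} [MeasurableSpace Ω] {P : Measure Ω} {ι : Type*}
    [Fintype ι] {Z : Ω → ι → ℝ} (h : IsGaussianVec P Z) (hZ : Measurable Z) :
    HasGaussianLaw Z P where
  isGaussian_map := by
    classical
    refine isGaussian_of_map_eq_gaussianReal fun L ↦ ?_
    obtain ⟨m, v, hmv⟩ := h fun i ↦ L (Pi.single i 1)
    refine ⟨m, v, ?_⟩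
    rw [Measure.map_map (by fun_prop) hZ, ← hmv]
    congr 1
    ext ω
    have := L.toLinearMap.pi_apply_eq_sum_univ (Z ω)
    simp only [ContinuousLinearMap.coe_coe, smul_eq_mul] at this
    rw [Function.comp_apply, this]
    refine Finset.sum_congr rfl fun i _ ↦ ?_
    rw [mul_comm]
    congr 2
    ext j
    simp [Pi.single_apply, eq_comm]

/-- An event whose conditional probability is idempotent agrees almost surely with an event of the
conditioning σ-algebra. -/
lemma exists_measurableSet_ae_eq_of_condExp_mul_self {Ω : Type*} {m mΩ : MeasurableSpace Ω}
    {P : Measure Ω} [IsProbabilityMeasure P] (hm : m ≤ mΩ) {s : Set Ω} (hs : MeasurableSet s)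
    (h : P[s.indicator (fun _ ↦ (1 : ℝ)) | m] =ᵐ[P] fun ω ↦
      (P[s.indicator (fun _ ↦ (1 : ℝ)) | m]) ω * (P[s.indicator (fun _ ↦ (1 : ℝ)) | m]) ω) :
    ∃ t, MeasurableSet[m] t ∧ s =ᵐ[P] t := by
  set p := P[s.indicator (fun _ ↦ (1 : ℝ)) | m] with hp
  have hpm : Measurable[m] p := stronglyMeasurable_condExp.measurable
  have hint : Integrable (s.indicator fun _ ↦ (1 : ℝ)) P :=
    (integrable_const (1 : ℝ)).indicator hs
  have ht : MeasurableSet[m] {ω | p ω = 1} := hpm (measurableSet_singleton 1)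
  have key (t : Set Ω) (ht : MeasurableSet[m] t) : ∫ ω in t, p ω ∂P = P.real (t ∩ s) := by
    rw [hp, setIntegral_condExp hm hint ht, setIntegral_indicator hs]
    simp
  refine ⟨{ω | p ω = 1}, ht, ?_⟩
  have h1 : P.real ({ω | p ω = 1} ∩ s) = P.real {ω | p ω = 1} := by
    rw [← key _ ht, setIntegral_congr_fun (g := fun _ ↦ (1 : ℝ)) (hm _ ht) fun ω hω ↦ hω]
    simp
  have h0 : P.real ({ω | p ω = 1}ᶜ ∩ s) = 0 := by
    rw [← key _ ht.compl]
    refine (setIntegral_congr_ae (g := fun _ ↦ (0 : ℝ)) (hm _ ht.compl) ?_).trans (by simp)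
    filter_upwards [h] with ω hω hne
    by_contra h0
    exact hne (mul_left_cancel₀ h0 (by rw [mul_one]; exact hω.symm))
  rw [ae_eq_set]
  constructor
  · rw [Set.sdiff_eq, Set.inter_comm]
    exact (measureReal_eq_zero_iff).1 h0
  · refine (measureReal_eq_zero_iff).1 ?_
    have := measureReal_inter_add_sdiff (μ := P) (s := {ω | p ω = 1}) hs
    linarith

/-- A real random variable all of whose lower level sets are almost surely pulled back along `T` is
almost surely a measurable function of `T`. -/
lemma exists_measurable_ae_eq_comp {Ω β : Type*} [MeasurableSpace Ω] [MeasurableSpace β]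
    {P : Measure Ω} {u : Ω → ℝ} {T : Ω → β}
    (h : ∀ q : ℝ, ∃ S, MeasurableSet S ∧ (u ⁻¹' Set.Iio q : Set Ω) =ᵐ[P] T ⁻¹' S) :
    ∃ G : β → ℝ, Measurable G ∧ u =ᵐ[P] G ∘ T := by
  classical
  choose S hS hSu using h
  refine ⟨fun x ↦ (⨅ q : ℚ, if x ∈ S q then ((q : ℝ) : EReal) else ⊤).toReal,
    Measurable.ereal_toReal (.iInf fun q ↦ .ite (hS q) (by fun_prop) (by fun_prop)), ?_⟩
  have hall : ∀ᵐ ω ∂P, ∀ q : ℚ, u ω < q ↔ T ω ∈ S q :=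
    ae_all_iff.2 fun q ↦ (hSu q).mem_iff
  filter_upwards [hall] with ω hω
  have : (⨅ q : ℚ, if T ω ∈ S q then ((q : ℝ) : EReal) else ⊤) = (u ω : EReal) := by
    refine iInf_eq_of_forall_ge_of_forall_gt_exists_lt (fun q ↦ ?_) fun c hc ↦ ?_
    · split_ifs with hq
      · exact_mod_cast ((hω q).2 hq).le
      · exact le_top
    · obtain ⟨q, hq, hqc⟩ := EReal.exists_rat_btwn_of_lt hc
      exact ⟨q, by rwa [if_pos ((hω q).1 (by exact_mod_cast hq))]⟩
  simp [this]

/-- Least squares: a square-integrable variable has a residual orthogonal to finitely many given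
square-integrable variables. -/
lemma exists_integral_residual_mul_eq_zero {Ω ι : Type*} [MeasurableSpace Ω] [Fintype ι]
    {P : Measure Ω} {u : Ω → ℝ} {w : ι → Ω → ℝ} (hu : MemLp u 2 P) (hw : ∀ i, MemLp (w i) 2 P) :
    ∃ b : ι → ℝ, ∀ k, ∫ ω, (u ω - ∑ i, b i * w i ω) * w k ω ∂P = 0 := by
  let E : Submodule ℝ (Lp ℝ 2 P) := Submodule.span ℝ (Set.range fun i ↦ (hw i).toLp (w i))
  have : FiniteDimensional ℝ E := FiniteDimensional.span_of_finite ℝ (Set.finite_range _)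
  obtain ⟨b, hb⟩ := (Submodule.mem_span_range_iff_exists_fun ℝ).1
    (E.starProjection_apply_mem (hu.toLp u))
  refine ⟨b, fun k ↦ ?_⟩
  have horth := E.sub_starProjection_mem_orthogonal (hu.toLp u)
  rw [Submodule.mem_orthogonal'] at horth
  have h0 := horth _ (Submodule.subset_span ⟨k, rfl⟩)
  have hres : MemLp (fun ω ↦ u ω - ∑ i, b i * w i ω) 2 P :=
    hu.sub (memLp_finsetSum _ fun i _ ↦ (hw i).const_mul (b i))
  have heq : hu.toLp u - E.starProjection (hu.toLp u) = hres.toLp _ := by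
    rw [← hb]
    apply Lp.ext
    have hsum := Lp.coeFn_finsetSum Finset.univ fun i ↦ b i • (hw i).toLp (w i)
    have hsmul : ∀ᵐ ω ∂P, ∀ i, (b i • (hw i).toLp (w i)) ω = b i * w i ω := by
      refine ae_all_iff.2 fun i ↦ ?_
      filter_upwards [Lp.coeFn_smul (b i) ((hw i).toLp (w i)), (hw i).coeFn_toLp] with ω h1 h2
      simp [h1, h2]
    filter_upwards [Lp.coeFn_sub (hu.toLp u) (∑ i, b i • (hw i).toLp (w i)), hu.coeFn_toLp,
      hres.coeFn_toLp, hsum, hsmul] with ω h1 h2 h3 h4 h5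
    rw [h1, Pi.sub_apply, h2, h3, h4, Finset.sum_apply]
    simp [h5]
  rw [heq, L2.inner_def] at h0
  rw [← h0]
  refine integral_congr_ae ?_
  filter_upwards [hres.coeFn_toLp, (hw k).coeFn_toLp] with ω h1 h2
  rw [h1, h2, real_inner_comm, RCLike.inner_apply, conj_trivial]

/-- A random variable with an atomless law that is independent of `W` is not a function of `W` and
of a countably-valued variable. -/
lemma not_ae_eq_comp_of_indepFun {Ω β ν : Type*} [MeasurableSpace Ω] [MeasurableSpace β]
    [MeasurableSpace ν] [Countable ν] {P : Measure Ω}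
    [IsProbabilityMeasure P] {e : Ω → ℝ} {W : Ω → β} (V : Ω → ν) (he : AEMeasurable e P)
    (hW : AEMeasurable W P) (hind : IndepFun W e P) [NullSingletonClass (P.map e)]
    {G : ν × β → ℝ} (hG : Measurable G) : ¬ ∀ᵐ ω ∂P, e ω = G (V ω, W ω) := by
  intro h
  have hnull (n : ν) : ∀ᵐ ω ∂P, e ω ≠ G (n, W ω) := by
    have hGn : Measurable fun w ↦ G (n, w) := by fun_prop
    have hs : MeasurableSet {x : β × ℝ | x.2 = G (n, x.1)} :=
      measurableSet_eq_fun (by fun_prop) (by fun_prop)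
    have hmap := (indepFun_iff_map_prod_eq_prod_map_map hW he).1 hind
    have : IsProbabilityMeasure (P.map e) := Measure.isProbabilityMeasure_map he
    have h0 : P.map (fun ω ↦ (W ω, e ω)) {x : β × ℝ | x.2 = G (n, x.1)} = 0 := by
      rw [hmap, Measure.measure_prod_null hs]
      exact .of_forall fun w ↦ measure_singleton (G (n, w))
    rw [Measure.map_apply_of_aemeasurable (hW.prodMk he) hs] at h0
    exact measure_eq_zero_iff_ae_notMem.1 h0
  have : ∀ᵐ ω ∂P, False := by
    filter_upwards [h, ae_all_iff.2 hnull] with ω h1 h2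
    exact h2 _ h1
  exact (IsProbabilityMeasure.ne_zero P) (by simpa using this)

/-- If a centred Gaussian variable, jointly Gaussian with `W`, is almost surely a function of `W`
and of a countably-valued variable, then it is almost surely a linear function of `W`. -/
lemma HasGaussianLaw.exists_ae_eq_sum_of_ae_eq_comp {Ω ι ν : Type*} [MeasurableSpace Ω]
    [Fintype ι] [MeasurableSpace ν] [Countable ν] {P : Measure Ω}
    {u : Ω → ℝ} {W : Ω → ι → ℝ} (hG : HasGaussianLaw (fun ω ↦ (u ω, W ω)) P)
    (hu : ∫ ω, u ω ∂P = 0) (hW : ∀ i, ∫ ω, W ω i ∂P = 0) (V : Ω → ν) {F : ν × (ι → ℝ) → ℝ}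
    (hF : Measurable F) (h : ∀ᵐ ω ∂P, u ω = F (V ω, W ω)) :
    ∃ b : ι → ℝ, ∀ᵐ ω ∂P, u ω = ∑ i, b i * W ω i := by
  have := hG.isProbabilityMeasure
  have hWlp (i : ι) : MemLp (fun ω ↦ W ω i) 2 P := (hG.snd.eval (X := fun i ω ↦ W ω i) i).memLp_two
  obtain ⟨b, hb⟩ := exists_integral_residual_mul_eq_zero hG.fst.memLp_two hWlp
  refine ⟨b, ?_⟩
  set e : Ω → ℝ := fun ω ↦ u ω - ∑ i, b i * W ω i with he
  let R : ℝ × (ι → ℝ) →L[ℝ] ℝ := .fst ℝ ℝ (ι → ℝ) -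
    ∑ i, b i • (ContinuousLinearMap.proj i ∘L .snd ℝ ℝ (ι → ℝ))
  have hR (ω : Ω) : R (u ω, W ω) = e ω := by simp [R, he]
  have heG : HasGaussianLaw e P := by
    simpa only [hR] using hG.map_fun R
  have heW : HasGaussianLaw (fun ω ↦ (W ω, fun _ : Unit ↦ e ω)) P := by
    simpa [hR, ContinuousLinearMap.pi_apply] using
      hG.map_fun ((ContinuousLinearMap.snd ℝ ℝ (ι → ℝ)).prod (.pi fun _ : Unit ↦ R))
  have hmean : ∫ ω, e ω ∂P = 0 := by
    rw [he, integral_sub hG.fst.integrable (integrable_finsetSum _ fun i _ ↦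
      ((hWlp i).integrable one_le_two).const_mul _), integral_finsetSum _ fun i _ ↦
      ((hWlp i).integrable one_le_two).const_mul _]
    simp [integral_const_mul, hu, hW]
  have hind : IndepFun W e P := by
    refine (HasGaussianLaw.indepFun_of_covariance_eval (X := fun i ω ↦ W ω i)
      (Y := fun (_ : Unit) ω ↦ e ω) heW fun i _ ↦ ?_).comp measurable_id (measurable_pi_apply ())
    rw [covariance_comm, covariance_eq_sub heG.memLp_two (hWlp i), hmean]
    simpa using hb i
  have hlaw := heG.map_eq_gaussianReal
  rw [hmean] at hlaw
  by_cases hv : Var[e; P].toNNReal = 0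
  · rw [hv, gaussianReal_zero_var] at hlaw
    have h0 : ∀ᵐ x ∂P.map e, x = 0 := by simp [hlaw]
    filter_upwards [ae_of_ae_map heG.aemeasurable h0] with ω hω
    exact sub_eq_zero.1 hω
  · have : NullSingletonClass (P.map e) := hlaw ▸ nullSingletonClass_gaussianReal hv
    refine absurd ?_ (not_ae_eq_comp_of_indepFun V heG.aemeasurable heW.fst.aemeasurable hind
      (G := fun x ↦ F x - ∑ i, b i * x.2 i) (by fun_prop))
    filter_upwards [h] with ω hω
    rw [he, ← hω]

/-- If `X` and `Y` are conditionally independent given `T`, then a real random variable which is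
almost surely both a function of `X` and a function of `Y` is almost surely a function of `T`. -/
lemma CondIndepRV.exists_ae_eq_comp {Ω α β γ : Type*} [MeasurableSpace Ω] [MeasurableSpace α]
    [MeasurableSpace β] [MeasurableSpace γ] {P : Measure Ω} [IsProbabilityMeasure P]
    {X : Ω → α} {Y : Ω → β} {T : Ω → γ} (hX : Measurable X) (hT : Measurable T)
    (hCI : CondIndepRV P (MeasurableSpace.comap T inferInstance) X Y) {f : α → ℝ} {g : β → ℝ}
    (hf : Measurable f) (hg : Measurable g) (hfg : ∀ᵐ ω ∂P, f (X ω) = g (Y ω)) :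
    ∃ G : γ → ℝ, Measurable G ∧ f ∘ X =ᵐ[P] G ∘ T := by
  refine exists_measurable_ae_eq_comp fun q ↦ ?_
  let s : Set Ω := X ⁻¹' (f ⁻¹' Set.Iio q)
  let s' : Set Ω := Y ⁻¹' (g ⁻¹' Set.Iio q)
  have hss' : s =ᵐ[P] s' := by
    refine Filter.eventuallyEq_set.2 ?_
    filter_upwards [hfg] with ω hω
    simp [s, s', hω]
  have hinter : (s ∩ s' : Set Ω) =ᵐ[P] s := by
    simpa using (ae_eq_refl s).inter hss'.symm
  have hmul : P[(s ∩ s').indicator fun _ ↦ (1 : ℝ) | .comap T inferInstance] =ᵐ[P]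
      fun ω ↦ (P[s.indicator fun _ ↦ (1 : ℝ) | .comap T inferInstance]) ω *
        (P[s'.indicator fun _ ↦ (1 : ℝ) | .comap T inferInstance]) ω :=
    hCI _ _ (hf measurableSet_Iio) (hg measurableSet_Iio)
  obtain ⟨t, ⟨S, hS, rfl⟩, hst⟩ := exists_measurableSet_ae_eq_of_condExp_mul_self (P := P)
    hT.comap_le (s := s) (hX (hf measurableSet_Iio)) <| by
    filter_upwards [hmul, condExp_congr_ae (m := .comap T inferInstance)
      (indicator_ae_eq_of_ae_eq_set (f := fun _ ↦ (1 : ℝ)) hinter),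
      condExp_congr_ae (m := .comap T inferInstance)
      (indicator_ae_eq_of_ae_eq_set (f := fun _ ↦ (1 : ℝ)) hss')] with ω h1 h2 h3
    exact h2.symm.trans (h1.trans (by rw [h3]))
  exact ⟨S, hS, hst⟩

/-- **Lemma 6 of the paper** (converse half of Theorem 1): if `(X, Y)` is a zero-mean
jointly Gaussian pair, `V` has finite entropy, `W = A ⬝ [X; Y]`, `X ⟂ Y | (V, W)`,
the covariance of `N_X X` is invertible, and `N_X X = N_Y Y` a.s. for some `N_Y`, then
`N_X X = A' W` a.s. for some matrix `A'`, and `d_W ≥ r`. -/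
theorem stmt4 {Ω : Type*} [MeasurableSpace Ω] (P : Measure Ω) [IsProbabilityMeasure P]
    {dX dY dW r : ℕ}
    (X : Ω → Fin dX → ℝ) (Y : Ω → Fin dY → ℝ)
    (hX : Measurable X) (hY : Measurable Y)
    (hGauss : IsGaussianVec P fun ω => Fin.append (X ω) (Y ω))
    (hmX : ∀ i, ∫ ω, X ω i ∂P = 0) (hmY : ∀ j, ∫ ω, Y ω j ∂P = 0)
    (V : Ω → ℕ) (hV : Measurable V) (hVent : HasFiniteEntropy P V)
    (A : Matrix (Fin dW) (Fin (dX + dY)) ℝ)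
    (W : Ω → Fin dW → ℝ) (hW : ∀ ω, W ω = A.mulVec (Fin.append (X ω) (Y ω)))
    (hCI : CondIndepRV P
      (MeasurableSpace.comap (fun ω => (V ω, W ω)) inferInstance) X Y)
    (NX : Matrix (Fin r) (Fin dX) ℝ)
    (K : Matrix (Fin r) (Fin r) ℝ)
    (hK : ∀ i j, K i j = ∫ ω, NX.mulVec (X ω) i * NX.mulVec (X ω) j ∂P)
    (hKdet : IsUnit K.det)
    (NY : Matrix (Fin r) (Fin dY) ℝ)
    (hNY : ∀ᵐ ω ∂P, NX.mulVec (X ω) = NY.mulVec (Y ω)) :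
    (∃ A' : Matrix (Fin r) (Fin dW) ℝ, ∀ᵐ ω ∂P, NX.mulVec (X ω) = A'.mulVec (W ω)) ∧
      r ≤ dW := by
  have hZ : Measurable fun ω ↦ Fin.append (X ω) (Y ω) := by
    refine measurable_pi_lambda _ fun i ↦ ?_
    refine Fin.addCases (fun j ↦ ?_) (fun j ↦ ?_) i
    · simpa using hX.eval
    · simpa using hY.eval
  have hZG := hGauss.hasGaussianLaw hZ
  have hZlp (i : Fin (dX + dY)) : MemLp (fun ω ↦ Fin.append (X ω) (Y ω) i) 2 P :=
    (hZG.eval (X := fun i ω ↦ Fin.append (X ω) (Y ω) i) i).memLp_two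
  have hZmean (i : Fin (dX + dY)) : ∫ ω, Fin.append (X ω) (Y ω) i ∂P = 0 := by
    refine Fin.addCases (fun j ↦ ?_) (fun j ↦ ?_) i
    · simpa using hmX j
    · simpa using hmY j
  have hsum_mean (c : Fin (dX + dY) → ℝ) :
      ∫ ω, ∑ i, c i * Fin.append (X ω) (Y ω) i ∂P = 0 := by
    rw [integral_finsetSum _ fun i _ ↦ ((hZlp i).integrable one_le_two).const_mul _]
    simp [integral_const_mul, hZmean]
  have hWapp (ω : Ω) (k : Fin dW) : W ω k = ∑ i, A k i * Fin.append (X ω) (Y ω) i := by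
    rw [hW]; rfl
  have hUapp (ω : Ω) (i : Fin r) : NX.mulVec (X ω) i =
      ∑ j, Fin.append (NX i) (0 : Fin dY → ℝ) j * Fin.append (X ω) (Y ω) j := by
    simp [Fin.sum_univ_add, mulVec, dotProduct]
  have hWm : Measurable W := by
    rw [funext hW]
    exact (by fun_prop : Measurable A.mulVec).comp hZ
  have hrow (i : Fin r) : ∃ b : Fin dW → ℝ,
      ∀ᵐ ω ∂P, NX.mulVec (X ω) i = ∑ k, b k * W ω k := by
    obtain ⟨G, hG, hGu⟩ := hCI.exists_ae_eq_comp hX (hV.prodMk hWm)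
      (f := fun x ↦ NX.mulVec x i) (g := fun y ↦ NY.mulVec y i) (by fun_prop) (by fun_prop)
      (hNY.mono fun ω h ↦ congrFun h i)
    refine HasGaussianLaw.exists_ae_eq_sum_of_ae_eq_comp (P := P) ?_ ?_ ?_ V hG hGu
    · have := hZG.map_fun ((LinearMap.toContinuousLinearMap
        (dotProductBilin ℝ ℝ (Fin.append (NX i) (0 : Fin dY → ℝ)))).prod
        (LinearMap.toContinuousLinearMap A.mulVecLin))
      convert! this using 3
      · exact hUapp _ i
      · exact hW _
    · simp_rw [hUapp]
      exact hsum_mean _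
    · intro k
      simp_rw [hWapp]
      exact hsum_mean _
  choose A' hA' using hrow
  refine ⟨⟨A', ?_⟩, ?_⟩
  · filter_upwards [ae_all_iff.2 hA'] with ω hω
    exact funext hω
  have hWlp (k : Fin dW) : MemLp (fun ω ↦ W ω k) 2 P := by
    simp_rw [hWapp]
    exact memLp_finsetSum _ fun i _ ↦ (hZlp i).const_mul _
  have hUlp (i : Fin r) : MemLp (fun ω ↦ NX.mulVec (X ω) i) 2 P := by
    simp_rw [hUapp]
    exact memLp_finsetSum _ fun i _ ↦ (hZlp i).const_mul _
  have hint (k : Fin dW) (j : Fin r) :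
      Integrable (fun ω ↦ W ω k * NX.mulVec (X ω) j) P :=
    (hWlp k).integrable_mul (hUlp j)
  have hfactor : K = of A' *
      (of fun k j ↦ ∫ ω, W ω k * NX.mulVec (X ω) j ∂P) := by
    ext i j
    have hcongr : (fun ω ↦ NX.mulVec (X ω) i * NX.mulVec (X ω) j) =ᵐ[P]
        fun ω ↦ ∑ k, A' i k * (W ω k * NX.mulVec (X ω) j) := by
      filter_upwards [hA' i] with ω hω
      simp_rw [← mul_assoc, ← Finset.sum_mul, ← hω]
    rw [hK, integral_congr_ae hcongr, integral_finsetSum _ fun k _ ↦ (hint k j).const_mul _]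
    simp [Matrix.mul_apply, integral_const_mul]
  calc r = K.rank := by simp [rank_of_isUnit K ((isUnit_iff_isUnit_det K).2 hKdet)]
    _ ≤ (of A').rank := hfactor ▸ rank_mul_le_left _ _
    _ ≤ dW := rank_le_width _

end
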